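/- Let ρ > 1, Q > 0, s > 0, and let integers M ≤ N be given with N ≥ 1. Let f : [-1,1] → ℝ be given by a uniformly convergent Chebyshev series f(x) = Σ_{n≥0} a_n T_n(x) with |a_0| ≤ Q and |a_n| ≤ 2Q ρ^{-n} for n ≥ 1. Let ε_vec be a random vector in ℝ^{N+1} with independent Gaussian coordinates of mean 0 and variance s², let c = (AᵀA)^{-1} Aᵀ (f(x^{equi}) + ε_vec) with A = T_M(x^{equi}), and set p_M(x) = Σ_{k=0}^M c_k T_k(x). Then E[ sup_{x ∈ [-1,1]} |f(x) − p_M(x)| ] ≤ (M+1)^{3/2} s / σ_{M+1}(A) + 2Q [ 1 + (M+1)(N+1)^{1/2} / σ_{M+1}(A) ] · ρ^{-M}/(ρ−1). -/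

import Mathlib

open Matrix MeasureTheory
open scoped BigOperators

/-- Chebyshev polynomial of the first kind `T_n`, as a function `ℝ → ℝ`. -/
noncomputable def cheb (n : ℕ) (x : ℝ) : ℝ :=
  (Polynomial.Chebyshev.T ℝ (n : ℤ)).eval x

/-- The equally spaced grid `x_k = 2k/N - 1`, `k = 0, …, N`, on `[-1,1]`. -/
noncomputable def xequi (N : ℕ) (k : Fin (N + 1)) : ℝ :=
  2 * (k : ℝ) / (N : ℝ) - 1

/-- The `(N+1) × (M+1)` Chebyshev–Vandermonde matrix at the equally spaced grid. -/
noncomputable def chebVand (N M : ℕ) : Matrix (Fin (N + 1)) (Fin (M + 1)) ℝ :=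
  Matrix.of fun i j => cheb (j : ℕ) (xequi N i)

/-- The Euclidean norm of a vector in `ℝ^n`. -/
noncomputable def enorm2 {n : ℕ} (v : Fin n → ℝ) : ℝ :=
  Real.sqrt (∑ i, (v i) ^ 2)

/-- The smallest singular value of a matrix, as the infimum of `‖A v‖₂` over unit vectors. -/
noncomputable def sigmaMin {m n : ℕ} (A : Matrix (Fin m) (Fin n) ℝ) : ℝ :=
  sInf {r | ∃ v : Fin n → ℝ, enorm2 v = 1 ∧ r = enorm2 (A.mulVec v)}

/-- The largest singular value of a matrix, as the supremum of `‖A v‖₂` over unit vectors. -/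
noncomputable def sigmaMax {m n : ℕ} (A : Matrix (Fin m) (Fin n) ℝ) : ℝ :=
  sSup {r | ∃ v : Fin n → ℝ, enorm2 v = 1 ∧ r = enorm2 (A.mulVec v)}

/-- The law of a vector of `N+1` independent mean-zero Gaussians of variance `s²`. -/
noncomputable def gaussVec (N : ℕ) (s : ℝ) : Measure (Fin (N + 1) → ℝ) :=
  Measure.pi fun _ => ProbabilityTheory.gaussianReal 0 ⟨s ^ 2, sq_nonneg s⟩


open ProbabilityTheory

lemma abs_cheb_le_one (n : ℕ) {x : ℝ} (hx : x ∈ Set.Icc (-1 : ℝ) 1) : |cheb n x| ≤ 1 :=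
  Polynomial.Chebyshev.abs_eval_T_real_le_one n (abs_le.2 hx)

lemma xequi_mem_Icc {N : ℕ} (hN : 1 ≤ N) (k : Fin (N + 1)) :
    xequi N k ∈ Set.Icc (-1 : ℝ) 1 := by
  have hN' : (0 : ℝ) < N := by exact_mod_cast hN
  have hk : (k : ℝ) ≤ N := by exact_mod_cast Fin.is_le k
  have h₀ : 0 ≤ 2 * (k : ℝ) / N := by positivity
  have h₂ : 2 * (k : ℝ) / N ≤ 2 := by
    rw [div_le_iff₀ hN']
    linarith
  unfold xequi
  constructor <;> linarith

lemma xequi_injective {N : ℕ} (hN : 1 ≤ N) : Function.Injective (xequi N) := by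
  intro k l h
  have hN' : (N : ℝ) ≠ 0 := by positivity
  unfold xequi at h
  field_simp at h
  have : (k : ℝ) = l := by linarith
  exact Fin.ext (by exact_mod_cast this)

/-- The Chebyshev polynomials of the first kind form a degree-graded sequence. -/
noncomputable def chebSequence : Polynomial.Sequence ℝ where
  elems' n := Polynomial.Chebyshev.T ℝ (n : ℤ)
  degree_eq' n := by simp

lemma chebVand_mulVec_injective {N M : ℕ} (hMN : M ≤ N) (hN : 1 ≤ N) :
    Function.Injective (chebVand N M).mulVec := by
  rw [← Matrix.coe_mulVecLin, injective_iff_map_eq_zero]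
  intro v hv
  set p : Polynomial ℝ := ∑ j : Fin (M + 1), v j • chebSequence j with hp
  have hp0 : p = 0 := by
    refine Polynomial.eq_zero_of_natDegree_lt_card_of_eval_eq_zero p (xequi_injective hN)
      (fun i => ?_) ?_
    · have := congrFun hv i
      simpa [hp, Polynomial.eval_finsetSum, Matrix.mulVec, dotProduct, chebVand, cheb, mul_comm,
        chebSequence] using this
    · have : p.natDegree ≤ M := by
        refine Polynomial.natDegree_sum_le_of_forall_le _ _ fun j _ => ?_
        refine (Polynomial.natDegree_smul_le _ _).trans ?_
        rw [chebSequence.natDegree_eq]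
        exact Fin.is_le j
      simpa using Nat.lt_succ_of_le (this.trans hMN)
  have hli := chebSequence.linearIndependent.comp (fun j : Fin (M + 1) => (j : ℕ))
    Fin.val_injective
  exact funext (Fintype.linearIndependent_iff.1 hli v hp0)

section Enorm

variable {m n : ℕ}

lemma enorm2_nonneg (v : Fin n → ℝ) : 0 ≤ enorm2 v := Real.sqrt_nonneg _

lemma sq_enorm2 (v : Fin n → ℝ) : enorm2 v ^ 2 = v ⬝ᵥ v := by
  rw [enorm2, Real.sq_sqrt (by positivity)]
  simp [dotProduct, sq]

lemma enorm2_smul (c : ℝ) (v : Fin n → ℝ) : enorm2 (c • v) = |c| * enorm2 v := by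
  simp [enorm2, mul_pow, ← Finset.mul_sum, Real.sqrt_mul (sq_nonneg c), Real.sqrt_sq_eq_abs]

lemma abs_dotProduct_le_enorm2_mul (u v : Fin n → ℝ) : |u ⬝ᵥ v| ≤ enorm2 u * enorm2 v := by
  rw [enorm2, enorm2, ← Real.sqrt_mul (by positivity)]
  exact Real.abs_le_sqrt (Finset.sum_mul_sq_le_sq_mul_sq _ _ _)

lemma abs_apply_le_enorm2 (v : Fin n → ℝ) (k : Fin n) : |v k| ≤ enorm2 v :=
  Real.abs_le_sqrt (Finset.single_le_sum (f := fun i => v i ^ 2)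
    (fun _ _ => sq_nonneg _) (Finset.mem_univ k))

lemma enorm2_le_of_abs_le {v : Fin n → ℝ} {C : ℝ} (hC : 0 ≤ C) (h : ∀ i, |v i| ≤ C) :
    enorm2 v ≤ √n * C := by
  rw [enorm2, ← Real.sqrt_sq hC, ← Real.sqrt_mul (by positivity)]
  refine Real.sqrt_le_sqrt ?_
  have : ∑ i, v i ^ 2 ≤ ∑ _i : Fin n, C ^ 2 :=
    Finset.sum_le_sum fun i _ => sq_le_sq' (abs_le.1 (h i)).1 (abs_le.1 (h i)).2
  simpa using this

lemma sigmaMin_le_of_enorm2_eq_one (A : Matrix (Fin m) (Fin n) ℝ) {v : Fin n → ℝ}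
    (hv : enorm2 v = 1) : sigmaMin A ≤ enorm2 (A *ᵥ v) := by
  refine csInf_le ⟨0, ?_⟩ ⟨v, hv, rfl⟩
  rintro _ ⟨w, -, rfl⟩
  exact enorm2_nonneg _

lemma sigmaMin_mul_enorm2_le (A : Matrix (Fin m) (Fin n) ℝ) (v : Fin n → ℝ) :
    sigmaMin A * enorm2 v ≤ enorm2 (A *ᵥ v) := by
  rcases (enorm2_nonneg v).eq_or_lt with h | h
  · rw [← h, mul_zero]
    exact enorm2_nonneg _
  · have h₁ : enorm2 ((enorm2 v)⁻¹ • v) = 1 := by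
      rw [enorm2_smul, abs_of_pos (inv_pos.2 h), inv_mul_cancel₀ h.ne']
    have h₂ := sigmaMin_le_of_enorm2_eq_one A h₁
    rwa [Matrix.mulVec_smul, enorm2_smul, abs_of_pos (inv_pos.2 h), inv_mul_eq_div,
      le_div_iff₀ h] at h₂

/-- The Moore–Penrose left inverse `(AᵀA)⁻¹Aᵀ` of a matrix with full column rank. -/
noncomputable def leftPinv (A : Matrix (Fin m) (Fin n) ℝ) : Matrix (Fin n) (Fin m) ℝ :=
  (A.transpose * A)⁻¹ * A.transpose

variable {A : Matrix (Fin m) (Fin n) ℝ}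

lemma leftPinv_mul_self (hA : Function.Injective A.mulVec) : leftPinv A * A = 1 := by
  have h : IsUnit (A.transpose * A) := (Matrix.PosDef.conjTranspose_mul_self A hA).isUnit
  rw [leftPinv, Matrix.mul_assoc,
    Matrix.nonsing_inv_mul _ ((Matrix.isUnit_iff_isUnit_det _).1 h)]

lemma leftPinv_dotProduct_mulVec (hA : Function.Injective A.mulVec) (v : Fin n → ℝ) (k : Fin n) :
    leftPinv A k ⬝ᵥ (A *ᵥ v) = v k := by
  change (leftPinv A *ᵥ (A *ᵥ v)) k = v k
  rw [Matrix.mulVec_mulVec, leftPinv_mul_self hA, Matrix.one_mulVec]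

lemma leftPinv_row_eq_mulVec (A : Matrix (Fin m) (Fin n) ℝ) (k : Fin n) :
    leftPinv A k = A *ᵥ (A.transpose * A)⁻¹ k := by
  ext i
  simp [leftPinv, Matrix.mul_apply, Matrix.mulVec, dotProduct, mul_comm]

lemma sigmaMin_pos [NeZero n] (hA : Function.Injective A.mulVec) : 0 < sigmaMin A := by
  set C := ∑ k, enorm2 (leftPinv A k) ^ 2
  have key : ∀ v : Fin n → ℝ, enorm2 v = 1 → 1 ≤ C * enorm2 (A *ᵥ v) ^ 2 := by
    intro v hv
    calc (1 : ℝ) = ∑ k, v k ^ 2 := by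
          have := sq_enorm2 v
          simpa [hv, dotProduct, ← sq] using this
      _ ≤ ∑ k, enorm2 (leftPinv A k) ^ 2 * enorm2 (A *ᵥ v) ^ 2 := by
          refine Finset.sum_le_sum fun k _ => ?_
          rw [← mul_pow, sq_le_sq, abs_of_nonneg (mul_nonneg (enorm2_nonneg _) (enorm2_nonneg _))]
          nth_rw 1 [← leftPinv_dotProduct_mulVec hA v k]
          exact abs_dotProduct_le_enorm2_mul _ _
      _ = C * enorm2 (A *ᵥ v) ^ 2 := by rw [Finset.sum_mul]
  have hne : enorm2 (Pi.single 0 1 : Fin n → ℝ) = 1 := by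
    have := sq_enorm2 (Pi.single 0 1 : Fin n → ℝ)
    simp only [single_one_dotProduct, Pi.single_eq_same] at this
    exact (pow_eq_one_iff_of_nonneg (enorm2_nonneg _) two_ne_zero).1 this
  have hC : 0 < C := by
    by_contra! h
    have := key _ hne
    nlinarith [sq_nonneg (enorm2 (A *ᵥ (Pi.single 0 1 : Fin n → ℝ)))]
  refine lt_of_lt_of_le (show 0 < √C⁻¹ by positivity) (le_csInf ⟨_, _, hne, rfl⟩ ?_)
  rintro _ ⟨v, hv, rfl⟩
  refine Real.sqrt_le_iff.2 ⟨enorm2_nonneg _, ?_⟩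
  rw [inv_le_iff_one_le_mul₀' hC]
  exact key v hv

lemma enorm2_leftPinv_row_le [NeZero n] (hA : Function.Injective A.mulVec) (k : Fin n) :
    enorm2 (leftPinv A k) ≤ (sigmaMin A)⁻¹ := by
  have hσ := sigmaMin_pos hA
  set w := (A.transpose * A)⁻¹ k
  have hr : leftPinv A k = A *ᵥ w := leftPinv_row_eq_mulVec A k
  have h₁ : enorm2 (leftPinv A k) ^ 2 ≤ enorm2 w := by
    rw [sq_enorm2]
    nth_rw 2 [hr]
    rw [leftPinv_dotProduct_mulVec hA]
    exact (le_abs_self _).trans (abs_apply_le_enorm2 w k)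
  have h₂ : sigmaMin A * enorm2 w ≤ enorm2 (leftPinv A k) := hr ▸ sigmaMin_mul_enorm2_le A w
  rw [← one_div, le_div_iff₀ hσ]
  rcases (enorm2_nonneg (leftPinv A k)).eq_or_lt with h | h
  · rw [← h]
    simp
  · refine le_of_mul_le_mul_right ?_ h
    nlinarith

end Enorm

lemma integral_abs_le_sqrt_integral_sq {Ω : Type*} {mΩ : MeasurableSpace Ω} {μ : Measure Ω}
    [IsProbabilityMeasure μ] {X : Ω → ℝ} (hX : MemLp X 2 μ) :
    ∫ ω, |X ω| ∂μ ≤ √(∫ ω, X ω ^ 2 ∂μ) := by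
  refine Real.le_sqrt_of_sq_le ?_
  have h := variance_eq_sub hX.abs
  have h₀ := variance_nonneg |X| μ
  simp only [Pi.abs_apply, Pi.pow_apply, sq_abs] at h
  linarith

section GaussVec

variable {N : ℕ} (s : ℝ)

lemma gaussVec_eq_pi :
    gaussVec N s = Measure.pi fun _ => gaussianReal 0 (s ^ 2).toNNReal := by
  have h : (s ^ 2).toNNReal = (⟨s ^ 2, sq_nonneg s⟩ : NNReal) :=
    Real.toNNReal_of_nonneg (sq_nonneg s)
  rw [h]
  rfl

instance : IsProbabilityMeasure (gaussVec N s) := by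
  rw [gaussVec_eq_pi]
  infer_instance

lemma memLp_dotProduct_gaussVec (r : Fin (N + 1) → ℝ) :
    MemLp (fun e => r ⬝ᵥ e) 2 (gaussVec N s) := by
  rw [gaussVec_eq_pi]
  refine memLp_finsetSum _ fun i _ => MemLp.const_mul ?_ _
  exact (memLp_id_gaussianReal' 2 (by simp)).comp_measurePreserving
    (measurePreserving_eval _ i)

lemma integral_dotProduct_gaussVec (r : Fin (N + 1) → ℝ) :
    ∫ e, r ⬝ᵥ e ∂(gaussVec N s) = 0 := by
  have h : ∀ i : Fin (N + 1), Integrable (fun e : Fin (N + 1) → ℝ => r i * e i)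
      (Measure.pi fun _ => gaussianReal 0 (s ^ 2).toNNReal) := fun i =>
    (integrable_comp_eval (f := id)
      ((memLp_id_gaussianReal' 1 (by simp)).integrable le_rfl)).const_mul _
  simp only [dotProduct, gaussVec_eq_pi]
  rw [integral_finsetSum _ fun i _ => h i]
  refine Finset.sum_eq_zero fun i _ => ?_
  rw [integral_const_mul, integral_eval, integral_id_gaussianReal, mul_zero]

lemma integral_sq_dotProduct_gaussVec (r : Fin (N + 1) → ℝ) :
    ∫ e, (r ⬝ᵥ e) ^ 2 ∂(gaussVec N s) = (s * enorm2 r) ^ 2 := by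
  rw [← variance_of_integral_eq_zero (memLp_dotProduct_gaussVec s r).aemeasurable
    (integral_dotProduct_gaussVec s r)]
  have h := variance_sum_pi (μ := fun _ : Fin (N + 1) => gaussianReal 0 (s ^ 2).toNNReal)
    (X := fun i x => r i * x)
    (fun i => (memLp_id_gaussianReal' 2 (by simp)).const_mul (r i))
  have hsum : (∑ i, fun e : Fin (N + 1) → ℝ => r i * e i) = fun e => r ⬝ᵥ e := by
    ext e
    simp [dotProduct]
  rw [hsum] at h
  rw [gaussVec_eq_pi, h]
  simp only [mul_pow, sq_enorm2, dotProduct, Finset.mul_sum]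
  refine Finset.sum_congr rfl fun i _ => ?_
  rw [variance_const_mul, variance_fun_id_gaussianReal, Real.coe_toNNReal _ (sq_nonneg s)]
  ring

lemma integral_abs_dotProduct_gaussVec_le (hs : 0 ≤ s) (r : Fin (N + 1) → ℝ) :
    ∫ e, |r ⬝ᵥ e| ∂(gaussVec N s) ≤ s * enorm2 r := by
  refine (integral_abs_le_sqrt_integral_sq (memLp_dotProduct_gaussVec s r)).trans_eq ?_
  rw [integral_sq_dotProduct_gaussVec, Real.sqrt_sq (mul_nonneg hs (enorm2_nonneg r))]

end GaussVec

lemma abs_sub_sum_cheb_le {ρ Q : ℝ} (hρ : 1 < ρ) {a : ℕ → ℝ}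
    (ha : ∀ n : ℕ, 1 ≤ n → |a n| ≤ 2 * Q * ρ ^ (-(n : ℤ))) {x y : ℝ}
    (hx : x ∈ Set.Icc (-1 : ℝ) 1) (hy : HasSum (fun n : ℕ => a n * cheb n x) y) (M : ℕ) :
    |y - ∑ k : Fin (M + 1), a k * cheb k x| ≤ 2 * Q * (ρ ^ (-(M : ℤ)) / (ρ - 1)) := by
  have hρ0 : 0 < ρ := by linarith
  rw [Fin.sum_univ_eq_sum_range (fun k => a k * cheb k x)]
  have h := (hasSum_nat_add_iff' (M + 1)).2 hy
  have hg := (hasSum_geometric_of_lt_one (inv_nonneg.2 hρ0.le)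
    (inv_lt_one_of_one_lt₀ hρ)).mul_left (2 * Q * ρ ^ (-((M + 1 : ℕ) : ℤ)))
  refine (h.norm_le_of_bounded hg fun n => ?_).trans_eq ?_
  · rw [Real.norm_eq_abs, abs_mul]
    refine (mul_le_of_le_one_right (abs_nonneg _) (abs_cheb_le_one _ hx)).trans
      ((ha _ (by omega)).trans_eq ?_)
    rw [_root_.zpow_neg, _root_.zpow_neg, zpow_natCast, zpow_natCast, pow_add, mul_inv, inv_pow]
    ring
  · have : ρ - 1 ≠ 0 := by linarith
    rw [_root_.zpow_neg, _root_.zpow_neg, zpow_natCast, zpow_natCast, pow_succ]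
    field_simp

/-- Pointwise error of the least squares fit, for a fixed noise vector `e`. -/
lemma abs_sub_leastSquares_le {M N : ℕ} (hMN : M ≤ N) (hN : 1 ≤ N) {f : ℝ → ℝ} {a : ℕ → ℝ}
    {δ : ℝ} (hδ : ∀ x ∈ Set.Icc (-1 : ℝ) 1, |f x - ∑ k : Fin (M + 1), a k * cheb k x| ≤ δ)
    (e : Fin (N + 1) → ℝ) {x : ℝ} (hx : x ∈ Set.Icc (-1 : ℝ) 1) :
    |f x - ∑ k : Fin (M + 1),
        (leftPinv (chebVand N M) *ᵥ fun i => f (xequi N i) + e i) k * cheb k x| ≤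
      (1 + (M + 1) * √(N + 1) / sigmaMin (chebVand N M)) * δ +
        ∑ k, |leftPinv (chebVand N M) k ⬝ᵥ e| := by
  set A := chebVand N M with hAdef
  have hA : Function.Injective A.mulVec := chebVand_mulVec_injective hMN hN
  have hδ0 : 0 ≤ δ := (abs_nonneg _).trans (hδ x hx)
  set t : Fin (N + 1) → ℝ := fun i => f (xequi N i) - (A *ᵥ fun k => a k) i with ht
  have htδ : enorm2 t ≤ √(N + 1) * δ := by
    have := enorm2_le_of_abs_le (v := t) hδ0 fun i => by
      have := hδ _ (xequi_mem_Icc hN i)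
      simpa [ht, hAdef, Matrix.mulVec, dotProduct, chebVand, mul_comm] using this
    simpa using this
  have hc : ∀ k, (leftPinv A *ᵥ fun i => f (xequi N i) + e i) k =
      a k + (leftPinv A k ⬝ᵥ t + leftPinv A k ⬝ᵥ e) := by
    intro k
    have hsplit : (fun i => f (xequi N i) + e i) = (A *ᵥ fun k => a k) + (t + e) := by
      ext i
      simp [ht]
      ring
    change leftPinv A k ⬝ᵥ _ = _
    rw [hsplit, dotProduct_add, dotProduct_add, leftPinv_dotProduct_mulVec hA]
  have hterm : ∀ k, |(leftPinv A k ⬝ᵥ t + leftPinv A k ⬝ᵥ e) * cheb k x| ≤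
      (sigmaMin A)⁻¹ * (√(N + 1) * δ) + |leftPinv A k ⬝ᵥ e| := by
    intro k
    rw [abs_mul]
    refine (mul_le_of_le_one_right (abs_nonneg _) (abs_cheb_le_one _ hx)).trans
      ((abs_add_le _ _).trans (add_le_add_left ?_ _))
    exact (abs_dotProduct_le_enorm2_mul _ _).trans (mul_le_mul (enorm2_leftPinv_row_le hA k) htδ
      (enorm2_nonneg _) (inv_nonneg.2 (sigmaMin_pos hA).le))
  have hsplit : f x - ∑ k : Fin (M + 1),
        (leftPinv A *ᵥ fun i => f (xequi N i) + e i) k * cheb k x =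
      (f x - ∑ k : Fin (M + 1), a k * cheb k x) -
        ∑ k : Fin (M + 1), (leftPinv A k ⬝ᵥ t + leftPinv A k ⬝ᵥ e) * cheb k x := by
    simp only [hc, add_mul (a _), Finset.sum_add_distrib]
    ring
  rw [hsplit]
  calc _ ≤ δ + ∑ k : Fin (M + 1), ((sigmaMin A)⁻¹ * (√(N + 1) * δ) + |leftPinv A k ⬝ᵥ e|) :=
        (abs_sub _ _).trans (add_le_add (hδ x hx)
          ((Finset.abs_sum_le_sum_abs _ _).trans (Finset.sum_le_sum fun k _ => hterm k)))
    _ = _ := by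
        rw [Finset.sum_add_distrib, Finset.sum_const, Finset.card_univ, Fintype.card_fin,
          nsmul_eq_mul]
        push_cast
        ring

/-- **Corollary 5.2 of the paper**: with samples perturbed by independent Gaussian
noise of mean `0` and variance `s²`, the least squares fit
`p_M = Σ c_k T_k`, `c = (AᵀA)⁻¹Aᵀ(f(x^equi) + ε_vec)`, `A = T_M(x^equi)`, satisfies
`E[sup_{x∈[-1,1]} |f(x) − p_M(x)|] ≤ (M+1)^{3/2} s/σ_{M+1}(A)
+ 2Q [1 + (M+1)√(N+1)/σ_{M+1}(A)] ρ^{-M}/(ρ−1)`. -/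
theorem least_squares_gaussian_uniform_error (ρ Q s : ℝ) (hρ : 1 < ρ) (hQ : 0 < Q)
    (hs : 0 < s) (M N : ℕ) (hMN : M ≤ N) (hN : 1 ≤ N)
    (f : ℝ → ℝ) (a : ℕ → ℝ)
    (hf : ∀ x ∈ Set.Icc (-1 : ℝ) 1, HasSum (fun n : ℕ => a n * cheb n x) (f x))
    (ha0 : |a 0| ≤ Q)
    (ha : ∀ n : ℕ, 1 ≤ n → |a n| ≤ 2 * Q * ρ ^ (-(n : ℤ))) :
    ∫ e : Fin (N + 1) → ℝ,
        sSup {y | ∃ x ∈ Set.Icc (-1 : ℝ) 1,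
          y = |f x - ∑ k : Fin (M + 1),
            ((((chebVand N M).transpose * chebVand N M)⁻¹ * (chebVand N M).transpose) *ᵥ
              (fun i => f (xequi N i) + e i)) k * cheb (k : ℕ) x|} ∂(gaussVec N s) ≤
      ((M : ℝ) + 1) ^ ((3 : ℝ) / 2) * s / sigmaMin (chebVand N M) +
        2 * Q * (1 + ((M : ℝ) + 1) * Real.sqrt ((N : ℝ) + 1) / sigmaMin (chebVand N M)) *
          (ρ ^ (-(M : ℤ)) / (ρ - 1)) := by
  set A := chebVand N M with hAdef
  have hA : Function.Injective A.mulVec := chebVand_mulVec_injective hMN hN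
  have hσ : 0 < sigmaMin A := sigmaMin_pos hA
  set δ : ℝ := 2 * Q * (ρ ^ (-(M : ℤ)) / (ρ - 1)) with hδ
  set C : ℝ := (1 + (M + 1) * √(N + 1) / sigmaMin A) * δ
  have hδ0 : 0 ≤ δ := by
    have : 0 < ρ - 1 := by linarith
    positivity
  have hint : ∀ k, Integrable (fun e => |leftPinv A k ⬝ᵥ e|) (gaussVec N s) := fun k =>
    ((memLp_dotProduct_gaussVec s (leftPinv A k)).integrable (by norm_num)).abs
  have hintsum := integrable_finsetSum Finset.univ fun k _ => hint k
  calc _ ≤ ∫ e, (C + ∑ k, |leftPinv A k ⬝ᵥ e|) ∂(gaussVec N s) := by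
        refine integral_mono_of_nonneg (Filter.Eventually.of_forall fun e => ?_)
          ((integrable_const C).add hintsum) (Filter.Eventually.of_forall fun e => ?_)
        · refine Real.sSup_nonneg ?_
          rintro _ ⟨x, -, rfl⟩
          exact abs_nonneg _
        · refine Real.sSup_le ?_ (by positivity)
          rintro _ ⟨x, hx, rfl⟩
          exact abs_sub_leastSquares_le hMN hN
            (fun x hx => abs_sub_sum_cheb_le hρ ha hx (hf x hx) M) e hx
    _ = C + ∑ k, ∫ e, |leftPinv A k ⬝ᵥ e| ∂(gaussVec N s) := by
        rw [integral_add (integrable_const C) hintsum, integral_finsetSum _ fun k _ => hint k]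
        simp
    _ ≤ C + ∑ _k : Fin (M + 1), s * (sigmaMin A)⁻¹ := by
        gcongr with k
        exact (integral_abs_dotProduct_gaussVec_le s hs.le _).trans
          (mul_le_mul_of_nonneg_left (enorm2_leftPinv_row_le hA k) hs.le)
    _ = ((M : ℝ) + 1) * s / sigmaMin A + C := by
        rw [Finset.sum_const, Finset.card_univ, Fintype.card_fin, nsmul_eq_mul]
        push_cast
        ring
    _ ≤ ((M : ℝ) + 1) ^ ((3 : ℝ) / 2) * s / sigmaMin A + C := by
        gcongr
        exact Real.self_le_rpow_of_one_le (by simp) (by norm_num)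
    _ = _ := by
        simp only [C, hδ]
        ring
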